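/- Suppose that the proper function f : X → (−∞,+∞] is a c-antiderivative of the mapping M : X ⇉ Y and that ∅ ≠ S ⊆ dom M. Then the lower envelope α_{[c,f|_S,M]} belongs to 𝒜_{[c,f|_S,M]}, i.e. it is the minimal c-convex c-antiderivative of M agreeing with f on S. Furthermore, (α_{[c,f|_S,M]})^c = γ_{[c,f^c|_{M(S)},M⁻¹]} and (γ_{[c,f|_S,M]})^c = α_{[c,f^c|_{M(S)},M⁻¹]}. -/

import Mathlib

/-- A function into `(-∞,+∞]` (modeled as `EReal` never taking `⊥`) is proper if it is
finite somewhere. -/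
def EProper {A : Type*} (f : A → EReal) : Prop :=
  (∀ a, f a ≠ ⊥) ∧ ∃ a, f a ≠ ⊤

/-- The `c`-transform `f^c(b) = sup_a (c(a,b) - f(a))`. -/
noncomputable def cTransform {A B : Type*} (k : A → B → ℝ) (f : A → EReal) : B → EReal :=
  fun b => ⨆ a, (k a b : EReal) - f a

/-- The `c`-subdifferential `∂_c f(a) = {b | ∀ a', f(a) + c(a',b) ≤ f(a') + c(a,b)}`. -/
def cSubdiff {A B : Type*} (k : A → B → ℝ) (f : A → EReal) (a : A) : Set B :=
  {b | ∀ a', f a + (k a' b : EReal) ≤ f a' + (k a b : EReal)}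

/-- A proper function `f` is `c`-convex if it is the `c`-transform of some
`(-∞,+∞]`-valued function on the other set. -/
def CConvexWith {A B : Type*} (k : A → B → ℝ) (f : A → EReal) : Prop :=
  EProper f ∧ ∃ g : B → EReal, (∀ b, g b ≠ ⊥) ∧ f = cTransform (fun b a => k a b) g

/-- `f` is a `c`-antiderivative of `M` if `G(M) ⊆ G(∂_c f)`. -/
def IsCAntideriv {A B : Type*} (k : A → B → ℝ) (f : A → EReal) (M : A → Set B) : Prop :=
  ∀ a b, b ∈ M a → b ∈ cSubdiff k f a

/-- The family `𝒜_{[c,f|_S,M]}` of all `c`-convex `c`-antiderivatives of `M`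
agreeing with `f` on `S`. -/
def AFam {A B : Type*} (k : A → B → ℝ) (f : A → EReal) (S : Set A) (M : A → Set B) :
    Set (A → EReal) :=
  {h | CConvexWith k h ∧ IsCAntideriv k h M ∧ ∀ s ∈ S, h s = f s}

theorem EReal.coe_sub_le_comm (r : ℝ) (a t : EReal) : (r : EReal) - a ≤ t ↔ (r : EReal) - t ≤ a := by
  induction a <;> induction t <;> simp [← EReal.coe_sub]
  grind

theorem EReal.add_coe_le_add_coe_iff (r s : ℝ) (a t : EReal) :
    a + (r : EReal) ≤ t + (s : EReal) ↔ a ≤ t + ((s - r : ℝ) : EReal) := by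
  induction a <;> induction t <;> simp [← EReal.coe_add, -EReal.coe_sub]
  grind

section
variable {A B : Type*} {k : A → B → ℝ}

theorem cTransform_le_iff {f : A → EReal} {g : B → EReal} :
    cTransform k f ≤ g ↔ cTransform (fun b a => k a b) g ≤ f := by
  simp only [cTransform, Pi.le_def, iSup_le_iff]
  rw [forall_comm]
  simp only [EReal.coe_sub_le_comm]

theorem cTransform_cTransform_le (f : A → EReal) :
    cTransform (fun b a => k a b) (cTransform k f) ≤ f :=
  cTransform_le_iff.1 le_rfl

theorem cTransform_antitone : Antitone (cTransform k) := fun f _ h =>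
  cTransform_le_iff.2 ((cTransform_cTransform_le f).trans h)

theorem cTransform_iInf₂ {ι : Type*} (F : Set ι) (φ : ι → A → EReal) :
    cTransform k (fun a => ⨅ h ∈ F, φ h a) = fun b => ⨆ h ∈ F, cTransform k (φ h) b := by
  have key : ∀ g : B → EReal, cTransform k (fun a => ⨅ h ∈ F, φ h a) ≤ g ↔
      (fun b => ⨆ h ∈ F, cTransform k (φ h) b) ≤ g := by
    intro g
    have hR : (fun b => ⨆ h ∈ F, cTransform k (φ h) b) ≤ g ↔
        ∀ h ∈ F, cTransform k (φ h) ≤ g := by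
      simp only [Pi.le_def, iSup_le_iff]
      exact ⟨fun H h hh b => H b h hh, fun H b h hh => H h hh b⟩
    rw [hR, cTransform_le_iff]
    simp only [cTransform_le_iff (g := g)]
    simp only [Pi.le_def, le_iInf_iff]
    exact ⟨fun H h hh b => H b h hh, fun H b h hh => H h hh b⟩
  exact le_antisymm ((key _).2 le_rfl) ((key _).1 le_rfl)

theorem CConvexWith.cTransform_cTransform {h : A → EReal} (hh : CConvexWith k h) :
    cTransform (fun b a => k a b) (cTransform k h) = h := by
  obtain ⟨-, g, -, rfl⟩ := hh
  exact le_antisymm (cTransform_cTransform_le _)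
    (cTransform_antitone (cTransform_cTransform_le (k := fun b a => k a b) g))

theorem IsCAntideriv.ne_top {f : A → EReal} {M : A → Set B} (hf : EProper f)
    (hM : IsCAntideriv k f M) {a : A} {b : B} (hb : b ∈ M a) : f a ≠ ⊤ := by
  obtain ⟨a', ha'⟩ := hf.2
  intro htop
  have h := hM a b hb a'
  lift f a' to ℝ using ⟨ha', hf.1 a'⟩ with r
  rw [htop, EReal.top_add_coe, ← EReal.coe_add] at h
  exact absurd (top_le_iff.1 h) (EReal.coe_ne_top _)

theorem cTransform_eq_of_mem_cSubdiff {f : A → EReal} {a : A} {b : B} (hbot : f a ≠ ⊥)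
    (htop : f a ≠ ⊤) (hb : b ∈ cSubdiff k f a) : cTransform k f b = (k a b : EReal) - f a := by
  refine le_antisymm (iSup_le fun a' => ?_) (le_iSup (fun a => (k a b : EReal) - f a) a)
  have h := hb a'
  lift f a to ℝ using ⟨htop, hbot⟩ with r
  generalize f a' = t at h ⊢
  induction t <;> simp_all [← EReal.coe_add, ← EReal.coe_sub]
  linarith

theorem IsCAntideriv.cTransform_eq {f : A → EReal} {M : A → Set B} (hf : EProper f)
    (hM : IsCAntideriv k f M) {a : A} {b : B} (hb : b ∈ M a) :
    cTransform k f b = (k a b : EReal) - f a :=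
  cTransform_eq_of_mem_cSubdiff (hf.1 a) (hM.ne_top hf hb) (hM a b hb)

theorem cTransform_ne_bot {f : A → EReal} (hf : EProper f) (b : B) : cTransform k f b ≠ ⊥ := by
  obtain ⟨a, ha⟩ := hf.2
  refine ne_bot_of_le_ne_bot ?_ (le_iSup (fun a => (k a b : EReal) - f a) a)
  have := hf.1 a
  lift f a to ℝ using ⟨ha, this⟩ with r
  exact EReal.coe_ne_bot (k a b - r)

theorem IsCAntideriv.cTransform_ne_top {f : A → EReal} {M : A → Set B} (hf : EProper f)
    (hM : IsCAntideriv k f M) {a : A} {b : B} (hb : b ∈ M a) : cTransform k f b ≠ ⊤ := by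
  rw [hM.cTransform_eq hf hb]
  have h1 := hM.ne_top hf hb
  have h2 := hf.1 a
  lift f a to ℝ using ⟨h1, h2⟩ with r
  exact EReal.coe_ne_top (k a b - r)

theorem IsCAntideriv.cTransform {f : A → EReal} {M : A → Set B} (hf : EProper f)
    (hM : IsCAntideriv k f M) :
    IsCAntideriv (fun b a => k a b) (cTransform k f) (fun b => {a | b ∈ M a}) := by
  intro b a hb b'
  have h := le_iSup (fun a => (k a b' : EReal) - f a) a
  change _ ≤ _root_.cTransform k f b' at h
  rw [hM.cTransform_eq hf hb]
  have h1 := hM.ne_top hf hb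
  have h2 := hf.1 a
  lift f a to ℝ using ⟨h1, h2⟩ with r
  generalize _root_.cTransform k f b' = t at h ⊢
  induction t <;> simp_all [← EReal.coe_add, ← EReal.coe_sub]
  linarith

theorem cTransform_mem_AFam {f h : A → EReal} {S : Set A} {M : A → Set B}
    (hf : EProper f) (hanti : IsCAntideriv k f M) (hS : S.Nonempty)
    (hSdom : ∀ s ∈ S, (M s).Nonempty) (hh : EProper h) (hhM : IsCAntideriv k h M)
    (hhS : ∀ s ∈ S, h s = f s) :
    cTransform k h ∈ AFam (fun b a => k a b) (cTransform k f) (⋃ s ∈ S, M s)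
      (fun b => {a | b ∈ M a}) := by
  refine ⟨⟨⟨cTransform_ne_bot hh, ?_⟩, h, hh.1, rfl⟩, hhM.cTransform hh, ?_⟩
  · obtain ⟨s, hs⟩ := hS
    obtain ⟨b, hb⟩ := hSdom s hs
    exact ⟨b, hhM.cTransform_ne_top hh hb⟩
  · intro b hb
    obtain ⟨s, hs, hb⟩ := Set.mem_iUnion₂.1 hb
    rw [hhM.cTransform_eq hh hb, hanti.cTransform_eq hf hb, hhS s hs]

theorem IsCAntideriv.cTransform_cTransform_eq {f : A → EReal} {M : A → Set B} (hf : EProper f)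
    (hM : IsCAntideriv k f M) {a : A} {b : B} (hb : b ∈ M a) :
    _root_.cTransform (fun b a => k a b) (_root_.cTransform k f) a = f a := by
  refine le_antisymm (cTransform_cTransform_le f a) ?_
  refine le_trans ?_ (le_iSup (fun b => (k a b : EReal) - _root_.cTransform k f b) b)
  rw [hM.cTransform_eq hf hb]
  have h1 := hM.ne_top hf hb
  have h2 := hf.1 a
  lift f a to ℝ using ⟨h1, h2⟩ with r
  simp [← EReal.coe_sub]

theorem upperEnvelope_mem_AFam {f : A → EReal} {S : Set A} {M : A → Set B}
    (hne : (AFam k f S M).Nonempty) (hS : ∃ s ∈ S, f s ≠ ⊤) :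
    (fun a => ⨆ h ∈ AFam k f S M, h a) ∈ AFam k f S M := by
  obtain ⟨h₀, h_mem₀⟩ := hne
  have hagree : ∀ s ∈ S, ⨆ h ∈ AFam k f S M, h s = f s := fun s hs =>
    le_antisymm (iSup₂_le fun h hh => (hh.2.2 s hs).le)
      ((h_mem₀.2.2 s hs).ge.trans (le_iSup₂_of_le h₀ h_mem₀ le_rfl))
  obtain ⟨s, hs, hfs⟩ := hS
  have hconj : (fun a => ⨆ h ∈ AFam k f S M, h a) =
      cTransform (fun b a => k a b) (fun b => ⨅ h ∈ AFam k f S M, cTransform k h b) := by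
    rw [cTransform_iInf₂]
    funext a
    exact biSup_congr fun h hh => (congrFun hh.1.cTransform_cTransform a).symm
  refine ⟨⟨⟨fun a => ne_bot_of_le_ne_bot (h_mem₀.1.1.1 a) (le_iSup₂_of_le h₀ h_mem₀ le_rfl),
    s, by simpa only [hagree s hs] using hfs⟩, _, fun b hb => hfs ?_, hconj⟩, ?_, hagree⟩
  · rw [← hagree s hs, congrFun hconj s, eq_top_iff]
    refine le_trans ?_ (le_iSup _ b)
    change ⊤ ≤ (k s b : EReal) - ⨅ h ∈ AFam k f S M, cTransform k h b
    rw [hb]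
    simp
  · intro a b hb a'
    rw [EReal.add_coe_le_add_coe_iff]
    refine iSup₂_le fun h hh => ((EReal.add_coe_le_add_coe_iff _ _ _ _).1
      (hh.2.1 a b hb a')).trans ?_
    exact add_le_add_left (le_iSup₂_of_le (f := fun h (_ : h ∈ AFam k f S M) => h a') h hh le_rfl) _

/-- The `c`-transform maps the family of the dual data back into the original family. -/
theorem cTransform_mem_AFam_of_mem_dual {f : A → EReal} {S : Set A} {M : A → Set B}
    (hf : EProper f) (hanti : IsCAntideriv k f M) (hS : S.Nonempty)
    (hSdom : ∀ s ∈ S, (M s).Nonempty) {g : B → EReal}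
    (hg : g ∈ AFam (fun b a => k a b) (cTransform k f) (⋃ s ∈ S, M s) (fun b => {a | b ∈ M a})) :
    cTransform (fun b a => k a b) g ∈ AFam k f S M := by
  have hTf := cTransform_mem_AFam hf hanti hS hSdom hf hanti fun _ _ => rfl
  have hdom : ∀ b ∈ ⋃ s ∈ S, M s, {a | b ∈ M a}.Nonempty := fun b hb => by
    obtain ⟨s, -, hb⟩ := Set.mem_iUnion₂.1 hb
    exact ⟨s, hb⟩
  have hne : (⋃ s ∈ S, M s).Nonempty := by
    obtain ⟨s, hs⟩ := hS
    obtain ⟨b, hb⟩ := hSdom s hs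
    exact ⟨b, Set.mem_iUnion₂.2 ⟨s, hs, hb⟩⟩
  obtain ⟨h1, h2, h3⟩ := cTransform_mem_AFam hTf.1.1 hTf.2.1 hne hdom hg.1.1 hg.2.1 hg.2.2
  refine ⟨h1, h2, fun s hs => ?_⟩
  obtain ⟨b, hb⟩ := hSdom s hs
  rw [h3 s (Set.mem_iUnion₂.2 ⟨b, Set.mem_iUnion₂.2 ⟨s, hs, hb⟩, hb⟩)]
  exact hanti.cTransform_cTransform_eq hf hb

theorem cTransform_lowerEnvelope {f : A → EReal} {S : Set A} {M : A → Set B}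
    (hf : EProper f) (hanti : IsCAntideriv k f M) (hS : S.Nonempty)
    (hSdom : ∀ s ∈ S, (M s).Nonempty) :
    cTransform k (fun a => ⨅ h ∈ AFam k f S M, h a) =
      fun b => ⨆ g ∈ AFam (fun b a => k a b) (cTransform k f) (⋃ s ∈ S, M s)
        (fun b => {a | b ∈ M a}), g b := by
  rw [cTransform_iInf₂ _ fun h => h]
  funext b
  refine le_antisymm (iSup₂_le fun h hh => ?_) (iSup₂_le fun g hg => ?_)
  · exact le_iSup₂_of_le (cTransform k h)
      (cTransform_mem_AFam hf hanti hS hSdom hh.1.1 hh.2.1 hh.2.2) le_rfl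
  · refine le_iSup₂_of_le _ (cTransform_mem_AFam_of_mem_dual hf hanti hS hSdom hg) ?_
    exact (congrFun hg.1.cTransform_cTransform b).ge

theorem lowerEnvelope_mem_AFam {f : A → EReal} {S : Set A} {M : A → Set B}
    (hf : EProper f) (hanti : IsCAntideriv k f M) (hS : S.Nonempty)
    (hSdom : ∀ s ∈ S, (M s).Nonempty) :
    (fun a => ⨅ h ∈ AFam k f S M, h a) ∈ AFam k f S M := by
  have hmem := cTransform_mem_AFam_of_mem_dual hf hanti hS hSdom <|
    upperEnvelope_mem_AFam ⟨_, cTransform_mem_AFam hf hanti hS hSdom hf hanti fun _ _ => rfl⟩ <| by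
      obtain ⟨s, hs⟩ := hS
      obtain ⟨b, hb⟩ := hSdom s hs
      exact ⟨b, Set.mem_iUnion₂.2 ⟨s, hs, hb⟩, hanti.cTransform_ne_top hf hb⟩
  rw [← cTransform_lowerEnvelope hf hanti hS hSdom] at hmem
  convert hmem using 1
  exact le_antisymm (fun a => iInf₂_le _ hmem) (cTransform_cTransform_le _)

end

/-- the lower envelope `α_{[c,f|_S,M]}` belongs to `𝒜_{[c,f|_S,M]}`
(it is the minimal `c`-convex `c`-antiderivative of `M` agreeing with `f` on `S`), and
`(α_{[c,f|_S,M]})^c = γ_{[c,f^c|_{M(S)},M⁻¹]}`, `(γ_{[c,f|_S,M]})^c = α_{[c,f^c|_{M(S)},M⁻¹]}`. -/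
theorem AFam_lowerEnvelope_mem_and_duality {X Y : Type*} [Nonempty X] [Nonempty Y]
    (c : X → Y → ℝ) (f : X → EReal) (hf : EProper f) (M : X → Set Y)
    (hanti : IsCAntideriv c f M) (S : Set X) (hS : S.Nonempty)
    (hSdom : ∀ s ∈ S, (M s).Nonempty) :
    (fun x => ⨅ h ∈ AFam c f S M, h x) ∈ AFam c f S M ∧
    cTransform c (fun x => ⨅ h ∈ AFam c f S M, h x) =
      (fun y => ⨆ k ∈ AFam (fun y x => c x y) (cTransform c f) (⋃ s ∈ S, M s)
        (fun y => {x | y ∈ M x}), k y) ∧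
    cTransform c (fun x => ⨆ h ∈ AFam c f S M, h x) =
      (fun y => ⨅ k ∈ AFam (fun y x => c x y) (cTransform c f) (⋃ s ∈ S, M s)
        (fun y => {x | y ∈ M x}), k y) := by
  refine ⟨lowerEnvelope_mem_AFam hf hanti hS hSdom,
    cTransform_lowerEnvelope hf hanti hS hSdom, ?_⟩
  have hTf := cTransform_mem_AFam hf hanti hS hSdom hf hanti fun _ _ => rfl
  have hdom : ∀ y ∈ ⋃ s ∈ S, M s, {x | y ∈ M x}.Nonempty := fun y hy => by
    obtain ⟨s, -, hy⟩ := Set.mem_iUnion₂.1 hy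
    exact ⟨s, hy⟩
  have hne : (⋃ s ∈ S, M s).Nonempty := by
    obtain ⟨s, hs⟩ := hS
    obtain ⟨y, hy⟩ := hSdom s hs
    exact ⟨y, Set.mem_iUnion₂.2 ⟨s, hs, hy⟩⟩
  have hα := lowerEnvelope_mem_AFam hTf.1.1 hTf.2.1 hne hdom
  rw [← hα.1.cTransform_cTransform]
  congr 1
  rw [cTransform_iInf₂ _ fun h => h]
  funext x
  refine le_antisymm (iSup₂_le fun h hh => ?_) (iSup₂_le fun g hg => ?_)
  · refine le_iSup₂_of_le _ (cTransform_mem_AFam hf hanti hS hSdom hh.1.1 hh.2.1 hh.2.2) ?_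
    exact (congrFun hh.1.cTransform_cTransform x).ge
  · exact le_iSup₂_of_le (cTransform (fun y x => c x y) g)
      (cTransform_mem_AFam_of_mem_dual hf hanti hS hSdom hg) le_rfl
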